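/- For every i with 1 ≤ i ≤ n−1, λ_i ≤ d_P(i, i+1) + λ_{i+1}, where d_P(i,i+1) = dist(v_i, v_{i+1}). -/

import Mathlib

/-- Path distance along `P` between vertices `a` and `b`. -/
noncomputable def dP {X : Type*} [MetricSpace X] (v : ℕ → X) (a b : ℕ) : ℝ :=
  ∑ m ∈ Finset.Ico (min a b) (max a b), dist (v m) (v (m + 1))

/-- Shortest-path distance in the augmented graph `G(i,j)`. -/
noncomputable def dG {X : Type*} [MetricSpace X] (v : ℕ → X) (i j a b : ℕ) : ℝ :=
  min (dP v a b)
    (min (dP v a i + dist (v i) (v j) + dP v j b)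
         (dP v a j + dist (v i) (v j) + dP v i b))

/-- Eccentricity of vertex `c` in `G(i,j)`: `max_{1 ≤ k ≤ n} dG(c,k)`. -/
noncomputable def ecc {X : Type*} [MetricSpace X] (v : ℕ → X) (n i j c : ℕ) : ℝ :=
  sSup ((fun k => dG v i j c k) '' Set.Icc 1 n)

/-- Radius of `G(i,j)`: `min_{1 ≤ c ≤ n} ecc(i,j,c)`. -/
noncomputable def rad {X : Type*} [MetricSpace X] (v : ℕ → X) (n i j : ℕ) : ℝ :=
  sInf ((fun c => ecc v n i j c) '' Set.Icc 1 n)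

/-- Optimal radius: `min_{1 ≤ i ≤ j ≤ n} rad(i,j)`. -/
noncomputable def rstar {X : Type*} [MetricSpace X] (v : ℕ → X) (n : ℕ) : ℝ :=
  sInf {x | ∃ i j : ℕ, 1 ≤ i ∧ i ≤ j ∧ j ≤ n ∧ x = rad v n i j}

/-- `λ_i = min_{i ≤ j ≤ n} max_{i ≤ k ≤ n} dG(i,j)(i,k)`. -/
noncomputable def lam {X : Type*} [MetricSpace X] (v : ℕ → X) (n i : ℕ) : ℝ :=
  sInf ((fun j => sSup ((fun k => dG v i j i k) '' Set.Icc i n)) '' Set.Icc i n)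

/-- `r_i = min_{1 ≤ c ≤ i} max( dP(1,c), dP(c,i) + λ_i )`. -/
noncomputable def rI {X : Type*} [MetricSpace X] (v : ℕ → X) (n i : ℕ) : ℝ :=
  sInf ((fun c => max (dP v 1 c) (dP v c i + lam v n i)) '' Set.Icc 1 i)

theorem dP_nn {X : Type*} [MetricSpace X] (v : ℕ → X) (a b : ℕ) : 0 ≤ dP v a b :=
  Finset.sum_nonneg fun _ _ => dist_nonneg

theorem dP_self' {X : Type*} [MetricSpace X] (v : ℕ → X) (a : ℕ) : dP v a a = 0 := by
  simp [dP]

theorem dG_nn {X : Type*} [MetricSpace X] (v : ℕ → X) (i j a b : ℕ) : 0 ≤ dG v i j a b := by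
  unfold dG
  have := dP_nn v
  refine le_min (this _ _) (le_min ?_ ?_) <;>
  exact add_nonneg (add_nonneg (this _ _) dist_nonneg) (this _ _)

theorem dP_one {X : Type*} [MetricSpace X] (v : ℕ → X) (i : ℕ) :
    dP v i (i + 1) = dist (v i) (v (i + 1)) := by
  simp [dP]

theorem dP_step {X : Type*} [MetricSpace X] (v : ℕ → X) (i k : ℕ) (h : i + 1 ≤ k) :
    dP v i k = dist (v i) (v (i + 1)) + dP v (i + 1) k := by
  unfold dP
  rw [min_eq_left (by omega), max_eq_right (by omega), min_eq_left h, max_eq_right h]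
  exact Finset.sum_eq_sum_Ico_succ_bot (by omega) _

theorem dG_step {X : Type*} [MetricSpace X] (v : ℕ → X) (i j k : ℕ) (h : i + 1 ≤ k) :
    dG v i j i k ≤ dP v i (i + 1) + dG v (i + 1) j (i + 1) k := by
  have h1 := dP_step v i k h
  have h2 := dP_one v i
  have h3 : dG v i j i k ≤ dP v i k := min_le_left _ _
  have h4 : dG v i j i k ≤ dP v i i + dist (v i) (v j) + dP v j k :=
    (min_le_right _ _).trans (min_le_left _ _)
  have h5 := dist_triangle (v i) (v (i + 1)) (v j)
  have h6 := dP_self' v i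
  have h7 := dP_self' v (i + 1)
  have h8 := dP_nn v (i + 1) j
  have h9 : 0 ≤ dist (v (i + 1)) (v j) := dist_nonneg
  rw [← sub_le_iff_le_add']
  refine le_min ?_ (le_min ?_ ?_) <;> linarith

/-- `λ_i ≤ dP(i,i+1) + λ_{i+1}` for `1 ≤ i ≤ n−1`. -/
theorem stmt_7 {X : Type*} [MetricSpace X] (n : ℕ) (hn : 2 ≤ n) (v : ℕ → X)
    (hv : Set.InjOn v (Set.Icc 1 n))
    (i : ℕ) (hi : 1 ≤ i) (hin : i ≤ n - 1) :
    lam v n i ≤ dP v i (i + 1) + lam v n (i + 1) := by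
  have hfin : ∀ (f : ℕ → ℝ) (a b : ℕ), (f '' Set.Icc a b).Finite :=
    fun f a b => (Set.finite_Icc a b).image f
  rw [← sub_le_iff_le_add']
  unfold lam
  refine le_csInf ((Set.nonempty_Icc.2 (by omega)).image _) ?_
  rintro _ ⟨j, ⟨hj1, hj2⟩, rfl⟩
  rw [sub_le_iff_le_add']
  refine (csInf_le (hfin _ _ _).bddBelow ⟨j, ⟨by omega, hj2⟩, rfl⟩).trans ?_
  refine csSup_le ((Set.nonempty_Icc.2 (by omega)).image _) ?_
  have key : ∀ k, i + 1 ≤ k → k ≤ n → dG v (i + 1) j (i + 1) k ≤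
      sSup ((fun k => dG v (i + 1) j (i + 1) k) '' Set.Icc (i + 1) n) :=
    fun k h1 h2 => le_csSup (hfin _ _ _).bddAbove ⟨k, ⟨h1, h2⟩, rfl⟩
  rintro _ ⟨k, ⟨hk1, hk2⟩, rfl⟩
  rcases Nat.eq_or_lt_of_le hk1 with rfl | hk
  · have h1 := key (i + 1) le_rfl (by omega)
    have h2 := dG_nn v (i + 1) j (i + 1) (i + 1)
    have h3 : dG v i j i i ≤ dP v i i := min_le_left _ _
    have h4 := dP_self' v i
    have h5 := dP_nn v i (i + 1)
    show dG v i j i i ≤ _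
    linarith
  · exact (dG_step v i j k hk).trans (add_le_add le_rfl (key k hk hk2))
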